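/- In the setting described in the context, define t̄_ε = min{t ≤ s_ε : z_ε(ξ) ≥ 0 for all ξ ∈ [t, s_ε]}, and let w*_r = (x*_r, y*_r) be the solution of the repulsive reduced system with initial condition x(0) = y(0) = 0. Then sup over t ∈ [t̄_ε, s_ε] of (|x_ε(t) − x*_r(t − t̄_ε)| + |y_ε(t) − y*_r(t − t̄_ε)|) tends to 0 as ε → 0 (along those ε for which the stated hypotheses hold). -/

import Mathlib

open Filter Topology Set

/-- Mean value bound. -/
lemma cn_lip {x dx : ℝ → ℝ} {M : ℝ} (hx : ∀ t, HasDerivAt x (dx t) t) (hd : ∀ t, |dx t| ≤ M)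
    (a b : ℝ) : |x b - x a| ≤ M * |b - a| := by
  have := Convex.norm_image_sub_le_of_norm_hasDerivWithin_le (f := x) (f' := dx) (s := univ) (C := M)
    (x := a) (y := b) (fun t _ => (hx t).hasDerivWithinAt) (fun t _ => hd t) convex_univ
    (mem_univ _) (mem_univ _)
  simpa using this

lemma cn_lip_le {x dx : ℝ → ℝ} {M : ℝ} (hx : ∀ t, HasDerivAt x (dx t) t) (hd : ∀ t, |dx t| ≤ M)
    {a b : ℝ} (hab : a ≤ b) : |x b - x a| ≤ M * (b - a) := by
  have := cn_lip hx hd a b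
  rwa [abs_of_nonneg (by linarith : 0 ≤ b - a)] at this

lemma cn_mono {h dh : ℝ → ℝ} {a b : ℝ} (hh : ∀ t, HasDerivAt h (dh t) t)
    (hd : ∀ t, a ≤ t → t ≤ b → 0 ≤ dh t) : ∀ s t, a ≤ s → s ≤ t → t ≤ b → h s ≤ h t := by
  have hm : MonotoneOn h (Icc a b) := by
    apply monotoneOn_of_hasDerivWithinAt_nonneg (convex_Icc a b) (f' := dh)
    · exact fun t _ => (hh t).continuousAt.continuousWithinAt
    · exact fun t _ => (hh t).hasDerivWithinAt
    · intro t ht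
      rw [interior_Icc] at ht
      exact hd t ht.1.le ht.2.le
  intro s t h1 h2 h3
  exact hm ⟨h1, h2.trans h3⟩ ⟨h1.trans h2, h3⟩ h2

lemma cn_mono_lin {h dh : ℝ → ℝ} {a b m : ℝ} (hh : ∀ t, HasDerivAt h (dh t) t) (hab : a ≤ b)
    (hd : ∀ t, a ≤ t → t ≤ b → m ≤ dh t) : h a + m * (b - a) ≤ h b := by
  have := cn_mono (h := fun t => h t - m * t) (dh := fun t => dh t - m) (a := a) (b := b)
    (fun t => ((hh t).fun_sub ((hasDerivAt_id t).const_mul m)).congr_deriv (by simp))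
    (fun t h1 h2 => by linarith [hd t h1 h2]) a b le_rfl hab le_rfl
  nlinarith

lemma cn_exp_deriv (c t : ℝ) : HasDerivAt (fun t => Real.exp (c * t)) (Real.exp (c * t) * c) t := by
  simpa using ((hasDerivAt_id t).const_mul c).exp

/-- integrating factor -/
lemma cn_factor {h dh : ℝ → ℝ} {a b c : ℝ} (hh : ∀ t, HasDerivAt h (dh t) t)
    (hd : ∀ t, a ≤ t → t ≤ b → 0 ≤ dh t + c * h t) :
    ∀ s t, a ≤ s → s ≤ t → t ≤ b → h s * Real.exp (c * s) ≤ h t * Real.exp (c * t) := by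
  apply cn_mono (dh := fun t => (dh t + c * h t) * Real.exp (c * t))
  · intro t
    exact ((hh t).fun_mul (cn_exp_deriv c t)).congr_deriv (by ring)
  · intro t h1 h2
    exact mul_nonneg (hd t h1 h2) (Real.exp_pos _).le

lemma cn_decay_one {v dv : ℝ → ℝ} {a b M ε : ℝ} (hε : 0 < ε) (hM : 0 ≤ M)
    (hv : ∀ t, HasDerivAt v (dv t) t)
    (hd : ∀ t, a ≤ t → t ≤ b → dv t + v t / ε ≤ M) :
    ∀ t, a ≤ t → t ≤ b → v t ≤ |v a| * Real.exp (-((t - a) / ε)) + M * ε := by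
  intro t h1 h2
  have := cn_factor (h := fun t => M * ε - v t) (dh := fun t => - dv t) (a := a) (b := b) (c := 1 / ε)
    (fun t => by simpa using (hv t).const_sub (M * ε))
    (fun t h1 h2 => by
      have := hd t h1 h2
      have e : 1 / ε * (M * ε - v t) = M - v t / ε := by field_simp
      rw [e]; linarith) a t le_rfl h1 h2
  have e1 : Real.exp (1 / ε * a) = Real.exp (1 / ε * t) * Real.exp (-((t - a) / ε)) := by
    rw [← Real.exp_add]; congr 1; field_simp; ring
  rw [e1] at this
  have p := Real.exp_pos (1 / ε * t)
  have q := Real.exp_pos (-((t - a) / ε))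
  have h3 : (M * ε - v a) * Real.exp (-((t - a) / ε)) ≤ M * ε - v t := by
    by_contra hc
    push Not at hc
    nlinarith
  have h4 : v a ≤ |v a| := le_abs_self _
  have : 0 ≤ M * ε * Real.exp (-((t - a) / ε)) := by positivity
  nlinarith

lemma cn_decay {v dv : ℝ → ℝ} {a b M ε : ℝ} (hε : 0 < ε) (hM : 0 ≤ M)
    (hv : ∀ t, HasDerivAt v (dv t) t)
    (hd : ∀ t, a ≤ t → t ≤ b → |dv t + v t / ε| ≤ M) :
    ∀ t, a ≤ t → t ≤ b → |v t| ≤ |v a| * Real.exp (-((t - a) / ε)) + M * ε := by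
  intro t h1 h2
  have A := cn_decay_one hε hM hv (fun t h1 h2 => (abs_le.1 (hd t h1 h2)).2) t h1 h2
  have B := cn_decay_one (v := fun t => - v t) (dv := fun t => - dv t) hε hM (fun t => (hv t).neg)
    (fun t h1 h2 => by have := (abs_le.1 (hd t h1 h2)).1; simp only [neg_div]; linarith) t h1 h2
  simp only [abs_neg] at B
  rw [abs_le]; constructor <;> linarith

lemma cn_decay_back {v dv : ℝ → ℝ} {a b M ε : ℝ} (hε : 0 < ε) (hM : 0 ≤ M)
    (hv : ∀ t, HasDerivAt v (dv t) t)
    (hd : ∀ t, a ≤ t → t ≤ b → |dv t - v t / ε| ≤ M) :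
    ∀ t, a ≤ t → t ≤ b → |v t| ≤ |v b| * Real.exp (-((b - t) / ε)) + M * ε := by
  intro t h1 h2
  have A := cn_decay (v := fun t => v (-t)) (dv := fun t => - dv (-t)) (a := -b) (b := -a) hε hM
    (fun t => ((hv (-t)).comp t (hasDerivAt_neg t)).congr_deriv (by ring))
    (fun t h1 h2 => by
      have := hd (-t) (by linarith) (by linarith)
      rw [← abs_neg] at this
      convert this using 2; ring) (-t) (by linarith) (by linarith)
  simp only [neg_neg] at A
  convert A using 5; ring

/-- planar Gronwall -/
lemma cn_gronwall {x y p q dx dy dp dq : ℝ → ℝ} {a b L e D : ℝ} (hL : 0 ≤ L) (he : 0 ≤ e)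
    (hx : ∀ t, HasDerivAt x (dx t) t) (hy : ∀ t, HasDerivAt y (dy t) t)
    (hp : ∀ t, HasDerivAt p (dp t) t) (hq : ∀ t, HasDerivAt q (dq t) t)
    (h1 : ∀ t, a ≤ t → t ≤ b → |dx t - dp t| ≤ L * (2 * |x t - p t| + |y t - q t|) + e)
    (h2 : ∀ t, a ≤ t → t ≤ b → |dy t - dq t| ≤ L * (2 * |x t - p t| + |y t - q t|) + e)
    (h3 : |x a - p a| ≤ D) (h4 : |y a - q a| ≤ D) :
    ∀ t, a ≤ t → t ≤ b → |x t - p t| ≤ (D + e) * Real.exp ((3 * L + 1) * (b - a)) ∧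
      |y t - q t| ≤ (D + e) * Real.exp ((3 * L + 1) * (b - a)) := by
  intro t ht ht'
  have hD : 0 ≤ D := (abs_nonneg _).trans h3
  have key := norm_le_gronwallBound_of_norm_deriv_right_le (E := ℝ × ℝ)
    (f := fun t => (x t - p t, y t - q t)) (f' := fun t => (dx t - dp t, dy t - dq t))
    (δ := D) (K := 3 * L + 1) (ε := e) (a := a) (b := b)
    (fun t _ => (((hx t).sub (hp t)).prodMk ((hy t).sub (hq t))).continuousAt.continuousWithinAt)
    (fun t _ => (((hx t).sub (hp t)).prodMk ((hy t).sub (hq t))).hasDerivWithinAt)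
    (by rw [Prod.norm_def]; exact max_le h3 h4)
    (by
      intro t ht
      have A : |x t - p t| ≤ ‖(x t - p t, y t - q t)‖ := norm_fst_le (x t - p t, y t - q t)
      have B : |y t - q t| ≤ ‖(x t - p t, y t - q t)‖ := norm_snd_le (x t - p t, y t - q t)
      have N := norm_nonneg (x t - p t, y t - q t)
      have C : L * (2 * |x t - p t| + |y t - q t|) ≤ L * (3 * ‖(x t - p t, y t - q t)‖) := by
        apply mul_le_mul_of_nonneg_left _ hL; linarith
      have C1 := h1 t ht.1 ht.2.le
      have C2 := h2 t ht.1 ht.2.le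
      rw [Prod.norm_def (dx t - dp t, dy t - dq t)]
      apply max_le
      · change |dx t - dp t| ≤ _; linarith
      · change |dy t - dq t| ≤ _; linarith) t ⟨ht, ht'⟩
  have bd : gronwallBound D (3 * L + 1) e (t - a) ≤ (D + e) * Real.exp ((3 * L + 1) * (b - a)) := by
    have K0 : (0 : ℝ) < 3 * L + 1 := by linarith
    rw [gronwallBound_of_K_ne_0 K0.ne']
    have E1 : Real.exp ((3 * L + 1) * (t - a)) ≤ Real.exp ((3 * L + 1) * (b - a)) := by
      apply Real.exp_le_exp.2; apply mul_le_mul_of_nonneg_left _ K0.le; linarith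
    have E2 : 1 ≤ Real.exp ((3 * L + 1) * (t - a)) := by
      apply Real.one_le_exp; apply mul_nonneg K0.le; linarith
    have E3 : e / (3 * L + 1) ≤ e := div_le_self he (by linarith)
    have E4 : e / (3 * L + 1) * (Real.exp ((3 * L + 1) * (t - a)) - 1)
        ≤ e * Real.exp ((3 * L + 1) * (b - a)) :=
      mul_le_mul E3 (by linarith) (by linarith) he
    have E5 := mul_le_mul_of_nonneg_left E1 hD
    linarith
  exact ⟨(norm_fst_le (x t - p t, y t - q t)).trans (key.trans bd),
    (norm_snd_le (x t - p t, y t - q t)).trans (key.trans bd)⟩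

/-- sign of the derivative at the right end of a negative excursion -/
lemma cn_deriv_right {z : ℝ → ℝ} {d a b : ℝ} (hab : a < b) (hz : HasDerivAt z d b) (hb : z b = 0)
    (hn : ∀ t, a < t → t < b → z t < 0) : 0 ≤ d := by
  have h := (hasDerivAt_iff_tendsto_slope.1 hz).mono_left
    (nhdsWithin_mono b (fun t (ht : t < b) => ht.ne) : 𝓝[<] b ≤ 𝓝[≠] b)
  refine ge_of_tendsto h ?_
  filter_upwards [Ioo_mem_nhdsLT hab] with t ht
  rw [slope_def_field, hb]
  have := hn t ht.1 ht.2
  exact (div_pos_of_neg_of_neg (by linarith) (by linarith [ht.2])).le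

lemma cn_deriv_left {z : ℝ → ℝ} {d a b : ℝ} (hab : a < b) (hz : HasDerivAt z d a) (hb : z a = 0)
    (hn : ∀ t, a < t → t < b → z t < 0) : d ≤ 0 := by
  have := cn_deriv_right (z := fun t => z (-t)) (d := -d) (a := -b) (b := -a) (by linarith)
    (by
      have h : HasDerivAt z d (- -a) := by simpa using hz
      exact (h.comp (-a) (hasDerivAt_neg (-a))).congr_deriv (by ring)) (by simpa using hb)
    (fun t h1 h2 => hn (-t) (by linarith) (by linarith))
  linarith

lemma cn_run {x z dx : ℝ → ℝ} {M ε : ℝ} (hε : 0 < ε) (hM : 0 < M)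
    (hx : ∀ t, HasDerivAt x (dx t) t) (hd : ∀ t, |dx t| ≤ M)
    (hz : ∀ t, HasDerivAt z ((x t + |z t|) / ε) t)
    {t s : ℝ} (hts : t < s) (hzz : z s ≤ z t) : x t + z t ≤ M * ε := by
  by_contra hc
  push Not at hc
  have key := cn_factor (h := fun t => x t + z t - M * ε) (dh := fun t => dx t + (x t + |z t|) / ε)
    (a := t) (b := s) (c := -(1 / ε))
    (fun t => by simpa using ((hx t).add (hz t)).sub_const (M * ε))
    (fun t _ _ => by
      have h1 := (abs_le.1 (hd t)).1
      have e : -(1 / ε) * (x t + z t - M * ε) = M - (x t + z t) / ε := by field_simp; ring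
      rw [e]
      have : (x t + z t) / ε ≤ (x t + |z t|) / ε := by
        gcongr; exact le_abs_self _
      linarith)
  have pos : ∀ r, t ≤ r → r ≤ s → 0 < x r + z r := by
    intro r h1 h2
    have := key t r le_rfl h1 h2
    have A : 0 < (x t + z t - M * ε) * Real.exp (-(1 / ε) * t) :=
      mul_pos (by linarith) (Real.exp_pos _)
    have B := pos_of_mul_pos_left (A.trans_le this) (Real.exp_pos _).le
    have : 0 < M * ε := by positivity
    linarith
  have : StrictMonoOn z (Icc t s) := by
    apply strictMonoOn_of_hasDerivWithinAt_pos (convex_Icc t s) (f' := fun t => (x t + |z t|) / ε)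
    · exact fun t _ => (hz t).continuousAt.continuousWithinAt
    · exact fun t _ => (hz t).hasDerivWithinAt
    · intro r hr
      rw [interior_Icc] at hr
      have := pos r hr.1.le hr.2.le
      have := le_abs_self (z r)
      apply div_pos _ hε
      linarith
  have := this ⟨le_rfl, hts.le⟩ ⟨hts.le, le_rfl⟩ hts
  linarith

lemma cn_low {x z : ℝ → ℝ} {ε K a b : ℝ} (hε : 0 < ε)
    (hz : ∀ t, HasDerivAt z ((x t + |z t|) / ε) t) (h0 : -K ≤ z a)
    (hx : ∀ t, a ≤ t → t ≤ b → -K ≤ x t) : ∀ t, a ≤ t → t ≤ b → -K ≤ z t := by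
  intro t h1 h2
  have := cn_factor (h := fun t => z t + K) (dh := fun t => (x t + |z t|) / ε)
    (a := a) (b := b) (c := (1 / ε))
    (fun t => by simpa using (hz t).add_const K)
    (fun t h1 h2 => by
      have e : (x t + |z t|) / ε + (1 / ε) * (z t + K) = (x t + K + (|z t| + z t)) / ε := by
        field_simp; ring
      rw [e]
      have := hx t h1 h2
      have := neg_abs_le (z t)
      apply div_nonneg _ hε.le; linarith) a t le_rfl h1 h2
  have A : 0 ≤ (z a + K) * Real.exp (1 / ε * a) := mul_nonneg (by linarith) (Real.exp_pos _).le
  have B := nonneg_of_mul_nonneg_left (A.trans this) (Real.exp_pos _)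
  linarith

/-- smallness -/
lemma cn_small (B M : ℝ) {σ : ℝ} (hσ : 0 < σ) :
    ∀ᶠ ε in 𝓝[>] (0 : ℝ), B * Real.exp (-(σ / ε)) + M * ε < σ := by
  have h1 : Tendsto (fun ε : ℝ => σ / ε) (𝓝[>] 0) atTop := by
    simpa [div_eq_mul_inv] using tendsto_inv_nhdsGT_zero.const_mul_atTop hσ
  have h2 := (Real.tendsto_exp_neg_atTop_nhds_zero.comp h1).const_mul B
  have h3 : Tendsto (fun ε : ℝ => M * ε) (𝓝[>] 0) (𝓝 (M * 0)) :=
    (tendsto_id.const_mul M).mono_left nhdsWithin_le_nhds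
  have h4 := h2.add h3
  simp only [mul_zero, add_zero] at h4
  exact h4.eventually (gt_mem_nhds hσ)

structure CFld (f g : ℝ → ℝ → ℝ → ℝ) (M lam : ℝ) : Prop where
  M0 : 0 < M
  l0 : 0 ≤ lam
  bf : ∀ x y z, |f x y z| ≤ M
  bg : ∀ x y z, |g x y z| ≤ M
  lf : ∀ x₁ y₁ z₁ x₂ y₂ z₂ : ℝ,
      |f x₁ y₁ z₁ - f x₂ y₂ z₂| ≤ lam * (|x₁ - x₂| + |y₁ - y₂| + |z₁ - z₂|)
  lg : ∀ x₁ y₁ z₁ x₂ y₂ z₂ : ℝ,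
      |g x₁ y₁ z₁ - g x₂ y₂ z₂| ≤ lam * (|x₁ - x₂| + |y₁ - y₂| + |z₁ - z₂|)

structure COrb (f g : ℝ → ℝ → ℝ → ℝ) (ε : ℝ) (x y z : ℝ → ℝ) : Prop where
  ε0 : 0 < ε
  hx : ∀ t, HasDerivAt x (f (x t) (y t) (z t)) t
  hy : ∀ t, HasDerivAt y (g (x t) (y t) (z t)) t
  hz : ∀ t, HasDerivAt z ((x t + |z t|) / ε) t

structure CRun (x z : ℝ → ℝ) (τ T th s tb : ℝ) : Prop where
  τth : τ < th
  zth : z th = 0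
  neg : ∀ t, τ < t → t < th → z t < 0
  xth : 0 ≤ x th
  thtb : th ≤ tb
  tbT : tb ≤ T
  Ts : T ≤ s
  zs : z s = 0
  zpos : ∀ t, tb ≤ t → t ≤ s → 0 ≤ z t
  zleft : ∀ t, t < tb → ∃ ξ, t ≤ ξ ∧ ξ < tb ∧ z ξ < 0

/-- tracking -/
lemma cn_track {f g : ℝ → ℝ → ℝ → ℝ} {M lam ε : ℝ} {x y z xa ya : ℝ → ℝ} (F : CFld f g M lam)
    (O : COrb f g ε x y z)
    (hxa : ∀ t : ℝ, HasDerivAt xa (f (xa t) (ya t) (xa t)) t)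
    (hya : ∀ t : ℝ, HasDerivAt ya (g (xa t) (ya t) (xa t)) t)
    {τ b T σ : ℝ} (hσ : 0 < σ) (hbT : b ≤ T)
    (ix : x τ = xa τ) (iy : y τ = ya τ) (iz : z τ = 0) (hneg : ∀ t, τ ≤ t → t ≤ b → z t ≤ 0)
    (hε : |x τ| * Real.exp (-(σ / ε)) + M * ε < σ) :
    (∀ t, τ + σ ≤ t → t ≤ b → |x t - z t| ≤ σ) ∧
    ∀ t, τ ≤ t → t ≤ b →
      |x t - xa t| ≤ ((2 * M + lam) * Real.exp ((3 * lam + 1) * (T - τ))) * σ ∧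
      |y t - ya t| ≤ ((2 * M + lam) * Real.exp ((3 * lam + 1) * (T - τ))) * σ := by
  have hM := F.M0
  have hl := F.l0
  have ε0 := O.ε0
  have V : ∀ t, τ + σ ≤ t → t ≤ b → |x t - z t| ≤ σ := by
    intro t h1 h2
    have := cn_decay (v := fun t => x t - z t) (a := τ) (b := b) ε0 hM.le
      (fun t => (O.hx t).sub (O.hz t))
      (fun t h1 h2 => by
        have := F.bf (x t) (y t) (z t)
        rw [abs_of_nonpos (hneg t h1 h2)]
        convert this using 2; ring) t (by linarith) h2
    simp only [iz, sub_zero] at this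
    have e : Real.exp (-((t - τ) / ε)) ≤ Real.exp (-(σ / ε)) := by
      apply Real.exp_le_exp.2; apply neg_le_neg; gcongr; linarith
    have := mul_le_mul_of_nonneg_left e (abs_nonneg (x τ))
    linarith
  refine ⟨V, ?_⟩
  have near : ∀ t, τ ≤ t → t ≤ τ + σ → |x t - xa t| ≤ 2 * M * σ ∧ |y t - ya t| ≤ 2 * M * σ := by
    intro t h1 h2
    have A := cn_lip O.hx (fun t => F.bf _ _ _) τ t
    have B := cn_lip O.hy (fun t => F.bg _ _ _) τ t
    have C := cn_lip hxa (fun t => F.bf _ _ _) τ t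
    have D := cn_lip hya (fun t => F.bg _ _ _) τ t
    rw [abs_of_nonneg (by linarith : 0 ≤ t - τ)] at A B C D
    have E : M * (t - τ) ≤ M * σ := by gcongr; linarith
    rw [abs_le] at A B C D
    refine ⟨abs_le.2 ⟨?_, ?_⟩, abs_le.2 ⟨?_, ?_⟩⟩ <;> linarith [A.1, A.2, B.1, B.2, C.1, C.2, D.1, D.2]
  intro t h1 h2
  by_cases h3 : t ≤ τ + σ
  · have E : 1 ≤ Real.exp ((3 * lam + 1) * (T - τ)) := by
      apply Real.one_le_exp; apply mul_nonneg <;> linarith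
    have : 2 * M * σ ≤ (2 * M + lam) * Real.exp ((3 * lam + 1) * (T - τ)) * σ := by
      apply mul_le_mul_of_nonneg_right _ hσ.le
      nlinarith
    exact ⟨(near t h1 h3).1.trans this, (near t h1 h3).2.trans this⟩
  · push Not at h3
    have lem : ∀ t, τ + σ ≤ t → t ≤ b → lam * (|x t - xa t| + |y t - ya t| + |z t - xa t|) ≤
        lam * (2 * |x t - xa t| + |y t - ya t|) + lam * σ := by
      intro t h1 h2
      rw [← mul_add]
      apply mul_le_mul_of_nonneg_left _ hl
      have h := V t h1 h2
      have : |z t - xa t| ≤ |x t - z t| + |x t - xa t| := by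
        rw [abs_sub_comm (x t) (z t)]; exact abs_sub_le _ _ _
      linarith
    have G := cn_gronwall (a := τ + σ) (b := b) (L := lam) (e := lam * σ) (D := 2 * M * σ) hl
      (by positivity) O.hx O.hy hxa hya
      (fun t h1 h2 => (F.lf _ _ _ _ _ _).trans (lem t h1 h2))
      (fun t h1 h2 => (F.lg _ _ _ _ _ _).trans (lem t h1 h2))
      (near _ (by linarith) le_rfl).1 (near _ (by linarith) le_rfl).2 t h3.le h2
    have : (2 * M * σ + lam * σ) * Real.exp ((3 * lam + 1) * (b - (τ + σ))) ≤
        (2 * M + lam) * Real.exp ((3 * lam + 1) * (T - τ)) * σ := by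
      rw [show (2 * M + lam) * Real.exp ((3 * lam + 1) * (T - τ)) * σ =
        (2 * M * σ + lam * σ) * Real.exp ((3 * lam + 1) * (T - τ)) by ring]
      gcongr <;> linarith
    exact ⟨G.1.trans this, G.2.trans this⟩

/-- final comparison -/
lemma cn_final {f g : ℝ → ℝ → ℝ → ℝ} {M lam ε : ℝ} {x y z xr yr : ℝ → ℝ} (F : CFld f g M lam)
    (O : COrb f g ε x y z)
    (hxr : ∀ t : ℝ, HasDerivAt xr (f (xr t) (yr t) (-(xr t))) t)
    (hyr : ∀ t : ℝ, HasDerivAt yr (g (xr t) (yr t) (-(xr t))) t)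
    (hxr0 : xr 0 = 0) (hyr0 : yr 0 = 0)
    {a s L σ κ B : ℝ} (hσ : 0 < σ) (hκ : 0 ≤ κ) (has : a ≤ s) (hL : s - a ≤ L)
    (ix : |x a| ≤ κ) (iy : |y a| ≤ κ) (iz : z s = 0) (hpos : ∀ t, a ≤ t → t ≤ s → 0 ≤ z t)
    (hB : |x s| ≤ B)
    (hε : B * Real.exp (-(σ / ε)) + M * ε < σ) :
    ∀ t, a ≤ t → t ≤ s →
      |x t - xr (t - a)| ≤ (κ + lam * σ) * Real.exp ((3 * lam + 1) * L) + 2 * M * σ ∧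
      |y t - yr (t - a)| ≤ (κ + lam * σ) * Real.exp ((3 * lam + 1) * L) + 2 * M * σ := by
  have hM := F.M0
  have hl := F.l0
  have ε0 := O.ε0
  have V : ∀ t, a ≤ t → t ≤ s - σ → |x t + z t| ≤ σ := by
    intro t h1 h2
    have := cn_decay_back (v := fun t => x t + z t) (a := a) (b := s) ε0 hM.le
      (fun t => (O.hx t).add (O.hz t))
      (fun t h1 h2 => by
        have := F.bf (x t) (y t) (z t)
        rw [abs_of_nonneg (hpos t h1 h2)]
        convert this using 2; ring) t h1 (by linarith)
    simp only [iz, add_zero] at this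
    have e : Real.exp (-((s - t) / ε)) ≤ Real.exp (-(σ / ε)) := by
      apply Real.exp_le_exp.2; apply neg_le_neg; gcongr; linarith
    have := mul_le_mul hB e (Real.exp_pos _).le ((abs_nonneg _).trans hB)
    linarith
  have sx : ∀ t, HasDerivAt (fun t => xr (t - a)) (f (xr (t - a)) (yr (t - a)) (-(xr (t - a)))) t :=
    fun t => (hxr (t - a)).comp_sub_const t a
  have sy : ∀ t, HasDerivAt (fun t => yr (t - a)) (g (xr (t - a)) (yr (t - a)) (-(xr (t - a)))) t :=
    fun t => (hyr (t - a)).comp_sub_const t a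
  have lem : ∀ t, a ≤ t → t ≤ s - σ →
      lam * (|x t - xr (t - a)| + |y t - yr (t - a)| + |z t - -(xr (t - a))|) ≤
        lam * (2 * |x t - xr (t - a)| + |y t - yr (t - a)|) + lam * σ := by
    intro t h1 h2
    rw [← mul_add]
    apply mul_le_mul_of_nonneg_left _ hl
    have h := V t h1 h2
    have : |z t - -(xr (t - a))| ≤ |x t + z t| + |x t - xr (t - a)| := by
      rw [show z t - -(xr (t - a)) = (x t + z t) - (x t - xr (t - a)) by ring]; exact abs_sub _ _
    linarith
  have G := cn_gronwall (a := a) (b := s - σ) (L := lam) (e := lam * σ) (D := κ) hl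
      (by positivity) O.hx O.hy sx sy
      (fun t h1 h2 => (F.lf _ _ _ _ _ _).trans (lem t h1 h2))
      (fun t h1 h2 => (F.lg _ _ _ _ _ _).trans (lem t h1 h2))
      (by simpa [hxr0] using ix) (by simpa [hyr0] using iy)
  have E1 : (κ + lam * σ) * Real.exp ((3 * lam + 1) * (s - σ - a)) ≤
      (κ + lam * σ) * Real.exp ((3 * lam + 1) * L) := by
    gcongr; linarith
  have G' : ∀ t, a ≤ t → (t ≤ s - σ ∨ t = a) →
      |x t - xr (t - a)| ≤ (κ + lam * σ) * Real.exp ((3 * lam + 1) * L) ∧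
      |y t - yr (t - a)| ≤ (κ + lam * σ) * Real.exp ((3 * lam + 1) * L) := by
    intro t h1 h2
    by_cases h3 : t ≤ s - σ
    · exact ⟨(G t h1 h3).1.trans E1, (G t h1 h3).2.trans E1⟩
    · have h4 : t = a := by tauto
      subst h4
      have E : 1 ≤ Real.exp ((3 * lam + 1) * L) := by
        apply Real.one_le_exp; apply mul_nonneg <;> linarith
      have : κ ≤ (κ + lam * σ) * Real.exp ((3 * lam + 1) * L) := by
        have : 0 ≤ lam * σ := by positivity
        nlinarith
      simpa [hxr0, hyr0] using And.intro (ix.trans this) (iy.trans this)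
  intro t h1 h2
  have step : ∀ r, a ≤ r → (r ≤ s - σ ∨ r = a) → r ≤ t → t - r ≤ σ →
      |x t - xr (t - a)| ≤ (κ + lam * σ) * Real.exp ((3 * lam + 1) * L) + 2 * M * σ ∧
      |y t - yr (t - a)| ≤ (κ + lam * σ) * Real.exp ((3 * lam + 1) * L) + 2 * M * σ := by
    intro r k1 k2 k3 k4
    have A := cn_lip O.hx (fun t => F.bf _ _ _) r t
    have B := cn_lip O.hy (fun t => F.bg _ _ _) r t
    have C := cn_lip sx (fun t => F.bf _ _ _) r t
    have D := cn_lip sy (fun t => F.bg _ _ _) r t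
    rw [abs_of_nonneg (by linarith : 0 ≤ t - r)] at A B C D
    have E : M * (t - r) ≤ M * σ := by gcongr
    obtain ⟨H1, H2⟩ := G' r k1 k2
    rw [abs_le] at A B C D H1 H2
    refine ⟨abs_le.2 ⟨?_, ?_⟩, abs_le.2 ⟨?_, ?_⟩⟩ <;>
      linarith [A.1, A.2, B.1, B.2, C.1, C.2, D.1, D.2, H1.1, H1.2, H2.1, H2.2]
  by_cases c1 : t ≤ s - σ
  · exact step t h1 (Or.inl c1) le_rfl (by linarith)
  · push Not at c1
    by_cases c2 : a ≤ s - σ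
    · exact step (s - σ) c2 (Or.inl le_rfl) c1.le (by linarith)
    · push Not at c2
      exact step a le_rfl (Or.inr rfl) h1 (by linarith)

lemma cn_last {h : ℝ → ℝ} (hc : Continuous h) {a b : ℝ} (hab : a ≤ b) (ha : h a ≤ 0) (hb : 0 < h b) :
    ∃ c, a ≤ c ∧ c < b ∧ h c = 0 ∧ ∀ t, c < t → t ≤ b → 0 < h t := by
  have hK : IsCompact (Icc a b ∩ {t | h t ≤ 0}) :=
    isCompact_Icc.inter_right (isClosed_le hc continuous_const)
  obtain ⟨c, ⟨⟨h1, h2⟩, h3⟩, h4⟩ := hK.exists_isGreatest ⟨a, ⟨le_rfl, hab⟩, ha⟩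
  have hpos : ∀ t, c < t → t ≤ b → 0 < h t := by
    intro t k1 k2
    by_contra k3
    have := h4 ⟨⟨h1.trans k1.le, k2⟩, not_lt.1 k3⟩
    linarith
  have hcb : c < b := by
    rcases h2.lt_or_eq with h | h
    · exact h
    · exfalso; rw [h] at h3; exact absurd hb (not_lt.2 h3)
  refine ⟨c, h1, hcb, le_antisymm h3 ?_, hpos⟩
  have : Tendsto h (𝓝[>] c) (𝓝 (h c)) := (hc.tendsto c).mono_left nhdsWithin_le_nhds
  refine ge_of_tendsto this ?_
  filter_upwards [Ioc_mem_nhdsGT hcb] with t ht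
  exact (hpos t ht.1 ht.2).le

lemma cn_first {h : ℝ → ℝ} (hc : Continuous h) {a b : ℝ} (hab : a ≤ b) (ha : 0 < h a) (hb : h b ≤ 0) :
    ∃ c, a < c ∧ c ≤ b ∧ h c = 0 ∧ ∀ t, a ≤ t → t < c → 0 < h t := by
  obtain ⟨c, h1, h2, h3, h4⟩ := cn_last (h := fun t => h (-t)) (a := -b) (b := -a)
    (hc.comp continuous_neg) (by linarith) (by simpa using hb) (by simpa using ha)
  refine ⟨-c, by linarith, by linarith, h3, fun t k1 k2 => ?_⟩
  simpa using h4 (-t) (by linarith) (by linarith)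

lemma cn_cpt {h : ℝ → ℝ} (hc : Continuous h) (a b : ℝ) (hn : ∀ t, a ≤ t → t ≤ b → h t < 0) :
    ∃ c > 0, ∀ t, a ≤ t → t ≤ b → h t ≤ -c := by
  by_cases hab : a ≤ b
  · obtain ⟨t, ht, hm⟩ := isCompact_Icc.exists_isMaxOn (nonempty_Icc.2 hab) hc.continuousOn
    exact ⟨-h t, by linarith [hn t ht.1 ht.2], fun r h1 h2 => by simpa using hm ⟨h1, h2⟩⟩
  · exact ⟨1, one_pos, fun t h1 h2 => absurd (h1.trans h2) hab⟩

lemma cn_cube {g : ℝ → ℝ → ℝ → ℝ} {lam δ : ℝ} (hl : 0 ≤ lam) (hδ : 0 < δ)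
    (lg : ∀ x₁ y₁ z₁ x₂ y₂ z₂ : ℝ,
      |g x₁ y₁ z₁ - g x₂ y₂ z₂| ≤ lam * (|x₁ - x₂| + |y₁ - y₂| + |z₁ - z₂|))
    (hg : ∀ x y z : ℝ, |x| ≤ δ → |y| ≤ δ → |z| ≤ δ → 0 < g x y z) :
    ∃ c > 0, ∀ x y z : ℝ, |x| ≤ δ → |y| ≤ δ → |z| ≤ δ → c ≤ g x y z := by
  have hc : Continuous (fun p : ℝ × ℝ × ℝ => g p.1 p.2.1 p.2.2) := by
    apply LipschitzWith.continuous (K := ⟨3 * lam, by positivity⟩)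
    apply LipschitzWith.of_dist_le_mul
    intro p q
    have h1 : |p.1 - q.1| ≤ dist p q := le_max_left _ _
    have h2 : dist p.2 q.2 ≤ dist p q := le_max_right _ _
    have h3 : |p.2.1 - q.2.1| ≤ dist p.2 q.2 := le_max_left _ _
    have h4 : |p.2.2 - q.2.2| ≤ dist p.2 q.2 := le_max_right _ _
    refine (lg _ _ _ _ _ _).trans ?_
    change _ ≤ 3 * lam * dist p q
    nlinarith
  have hK : IsCompact (Icc (-δ) δ ×ˢ (Icc (-δ) δ ×ˢ Icc (-δ) δ)) :=
    isCompact_Icc.prod (isCompact_Icc.prod isCompact_Icc)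
  have m0 : (0 : ℝ) ∈ Icc (-δ) δ := ⟨by linarith, hδ.le⟩
  obtain ⟨p, ⟨hp1, hp2, hp3⟩, hm⟩ := hK.exists_isMinOn ⟨(0, 0, 0), m0, m0, m0⟩ hc.continuousOn
  refine ⟨_, hg _ _ _ (abs_le.2 hp1) (abs_le.2 hp2) (abs_le.2 hp3), fun x y z h1 h2 h3 => ?_⟩
  exact hm (show (x, y, z) ∈ _ from ⟨abs_le.1 h1, abs_le.1 h2, abs_le.1 h3⟩)

lemma cn_reduced {f g : ℝ → ℝ → ℝ → ℝ} {M lam δ ρ ttil : ℝ} {xa ya : ℝ → ℝ} (F : CFld f g M lam)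
    (hyf : ∀ y : ℝ, y ≠ 0 → y * f 0 y 0 < 0)
    (hgpos : ∀ x y z : ℝ, |x| ≤ δ → |y| ≤ δ → |z| ≤ δ → 0 < g x y z)
    (hρδ : 2 * M * ρ < δ)
    (hxa : ∀ t : ℝ, HasDerivAt xa (f (xa t) (ya t) (xa t)) t)
    (hya : ∀ t : ℝ, HasDerivAt ya (g (xa t) (ya t) (xa t)) t)
    (hx : xa ttil ≤ 0) (hy : ya ttil = 0) :
    ∀ t, ttil < t → t ≤ ttil + ρ → xa t < 0 := by
  have hM := F.M0
  have hl := F.l0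
  intro t1 k1 k2
  by_contra hc
  push Not at hc
  have X := fun {a t : ℝ} (h : a ≤ t) => cn_lip_le hxa (fun t => F.bf _ _ _) h
  have Y := fun {a t : ℝ} (h : a ≤ t) => cn_lip_le hya (fun t => F.bg _ _ _) h
  have bx : ∀ t, ttil ≤ t → t ≤ t1 → |xa t| ≤ δ := by
    intro t h1 h2
    have A := X h1
    have B := X h2
    rw [abs_le] at A B ⊢
    constructor <;> nlinarith [A.1, A.2, B.1, B.2]
  have byy : ∀ t, ttil ≤ t → t ≤ t1 → |ya t| ≤ δ := by
    intro t h1 h2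
    have A := Y h1
    rw [hy, sub_zero] at A
    nlinarith
  have ypos : ∀ t, ttil < t → t ≤ t1 → 0 < ya t := by
    intro t h1 h2
    have : StrictMonoOn ya (Icc ttil t1) := by
      apply strictMonoOn_of_hasDerivWithinAt_pos (convex_Icc _ _) (f' := fun t => g (xa t) (ya t) (xa t))
      · exact fun t _ => (hya t).continuousAt.continuousWithinAt
      · exact fun t _ => (hya t).hasDerivWithinAt
      · intro r hr
        rw [interior_Icc] at hr
        have b1 := bx r hr.1.le hr.2.le
        exact hgpos _ _ _ b1 (byy r hr.1.le hr.2.le) b1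
    have := this ⟨le_rfl, k1.le⟩ ⟨h1.le, h2⟩ h1
    linarith
  have fneg : ∀ t, ttil < t → t ≤ t1 → f 0 (ya t) 0 < 0 := by
    intro t h1 h2
    have p := ypos t h1 h2
    have := hyf _ p.ne'
    by_contra h
    push Not at h
    nlinarith
  have xc : Continuous xa := continuous_iff_continuousAt.2 fun t => (hxa t).continuousAt
  have xnon : ∀ t, ttil ≤ t → t ≤ t1 → xa t ≤ 0 := by
    intro t2 h1 h2
    by_contra h3
    push Not at h3
    obtain ⟨c, c1, c2, c3, c4⟩ := cn_last xc h1 hx h3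
    have fle : ∀ t, ttil ≤ t → t ≤ t2 → f 0 (ya t) 0 ≤ 0 := by
      intro t h4 h5
      rcases h4.lt_or_eq with h | h
      · exact (fneg t h (h5.trans h2)).le
      · rw [← h, hy]
        have : Tendsto (fun t => f 0 (ya t) 0) (𝓝[>] ttil) (𝓝 (f 0 (ya ttil) 0)) := by
          rw [tendsto_iff_dist_tendsto_zero]
          have yc : Tendsto ya (𝓝[>] ttil) (𝓝 (ya ttil)) :=
            (hya ttil).continuousAt.tendsto.mono_left nhdsWithin_le_nhds
          have := (tendsto_iff_dist_tendsto_zero.1 yc).const_mul lam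
          rw [mul_zero] at this
          refine squeeze_zero (fun _ => dist_nonneg) (fun t => ?_) this
          simpa [Real.dist_eq] using F.lf 0 (ya t) 0 0 (ya ttil) 0
        rw [hy] at this
        refine le_of_tendsto this ?_
        filter_upwards [Ioc_mem_nhdsGT k1] with t ht
        exact (fneg t ht.1 ht.2).le
    have := cn_factor (h := fun t => - xa t) (dh := fun t => - f (xa t) (ya t) (xa t))
      (a := c) (b := t2) (c := -(2 * lam)) (fun t => (hxa t).neg)
      (fun t h4 h5 => by
        have A := (abs_le.1 (F.lf (xa t) (ya t) (xa t) 0 (ya t) 0)).2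
        have B := fle t (c1.trans h4) h5
        have C : 0 ≤ xa t := by
          rcases h4.lt_or_eq with h | h
          · exact (c4 t h h5).le
          · rw [← h, c3]
        simp only [sub_zero, sub_self, abs_zero, abs_of_nonneg C] at A
        linarith) c t2 le_rfl c2.le le_rfl
    rw [c3] at this
    have := Real.exp_pos (-(2 * lam) * t2)
    nlinarith
  have hz : xa t1 = 0 := le_antisymm (xnon t1 k1.le le_rfl) hc
  have d := hxa t1
  rw [hz] at d
  have dn := fneg t1 k1 le_rfl
  have h := (hasDerivAt_iff_tendsto_slope.1 d).mono_left
    (nhdsWithin_mono t1 (fun t (ht : t < t1) => ht.ne) : 𝓝[<] t1 ≤ 𝓝[≠] t1)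
  have : 0 ≤ f 0 (ya t1) 0 := by
    refine ge_of_tendsto h ?_
    filter_upwards [Ioo_mem_nhdsLT k1] with t ht
    rw [slope_def_field, hz]
    have := xnon t ht.1.le ht.2.le
    exact div_nonneg_of_nonpos (by linarith) (by linarith [ht.2])
  linarith

lemma cn_near {f g : ℝ → ℝ → ℝ → ℝ} {M lam ρ τ ttil κ : ℝ} {xa ya : ℝ → ℝ} (F : CFld f g M lam)
    (hxa : ∀ t : ℝ, HasDerivAt xa (f (xa t) (ya t) (xa t)) t)
    (hya : ∀ t : ℝ, HasDerivAt ya (g (xa t) (ya t) (xa t)) t)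
    (hτ : τ < ttil) (hneg : ∀ t, τ ≤ t → t < ttil → xa t < 0)
    (haft : (∀ t, ttil < t → t ≤ ttil + ρ → xa t < 0) ∨
      (∀ κ > 0, ∃ t2, ttil < t2 ∧ t2 < ttil + κ ∧ 0 < xa t2)) (hκ : 0 < κ) :
    ∀ᶠ ε in 𝓝[>] (0 : ℝ), ∀ (x y z : ℝ → ℝ) (s th tb : ℝ), COrb f g ε x y z → x τ = xa τ →
      y τ = ya τ → z τ = 0 → CRun x z τ (ttil + ρ) th s tb →
      |th - ttil| ≤ κ ∧ |x th - xa ttil| ≤ κ ∧ |y th - ya ttil| ≤ κ := by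
  have hM := F.M0
  have hl := F.l0
  have xc : Continuous xa := continuous_iff_continuousAt.2 fun t => (hxa t).continuousAt
  obtain ⟨k, hk⟩ : ∃ k, k = κ / (2 * M + 1) := ⟨_, rfl⟩
  have k0 : 0 < k := by rw [hk]; positivity
  have kκ : k * (2 * M + 1) = κ := by rw [hk]; field_simp
  obtain ⟨C, hC⟩ : ∃ C, C = (2 * M + lam) * Real.exp ((3 * lam + 1) * (ttil + ρ - τ)) := ⟨_, rfl⟩
  have C0 : 0 ≤ C := by rw [hC]; positivity
  obtain ⟨c1, c10, hc1⟩ := cn_cpt xc τ (ttil - k) (fun t h1 h2 => hneg t h1 (by linarith))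
  -- the constant for the upper bound
  have up : ∃ c2 > 0, (∀ t, ttil + k ≤ t → t ≤ ttil + ρ → xa t ≤ -c2) ∨
      (∃ t2, ttil < t2 ∧ t2 < ttil + k ∧ c2 ≤ xa t2) := by
    rcases haft with h | h
    · obtain ⟨c, c0, hc⟩ := cn_cpt xc (ttil + k) (ttil + ρ) (fun t h1 h2 => h t (by linarith) h2)
      exact ⟨c, c0, Or.inl hc⟩
    · obtain ⟨t2, h1, h2, h3⟩ := h k k0
      exact ⟨xa t2, h3, Or.inr ⟨t2, h1, h2, le_rfl⟩⟩
  obtain ⟨c2, c20, hc2⟩ := up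
  obtain ⟨m, hm⟩ : ∃ m, m = min (min c1 c2) (min (κ / 2) (ttil - τ)) := ⟨_, rfl⟩
  have m0 : 0 < m := by
    rw [hm]; refine lt_min (lt_min c10 c20) (lt_min (by linarith) (by linarith))
  have m1 : m ≤ c1 := by rw [hm]; exact (min_le_left _ _).trans (min_le_left _ _)
  have m2 : m ≤ c2 := by rw [hm]; exact (min_le_left _ _).trans (min_le_right _ _)
  have m3 : m ≤ κ / 2 := by rw [hm]; exact (min_le_right _ _).trans (min_le_left _ _)
  have m4 : m ≤ ttil - τ := by rw [hm]; exact (min_le_right _ _).trans (min_le_right _ _)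
  obtain ⟨σ, hσ⟩ : ∃ σ, σ = m / (2 * (C + 1)) := ⟨_, rfl⟩
  have σ0 : 0 < σ := by rw [hσ]; positivity
  have σm : (C + 1) * σ = m / 2 := by rw [hσ]; field_simp
  have Cσ : 0 ≤ C * σ := by positivity
  filter_upwards [cn_small (|xa τ|) M σ0] with ε hε x y z s th tb O ix iy iz R
  have nonpos : ∀ t, τ ≤ t → t ≤ th → z t ≤ 0 := by
    intro t h1 h2
    rcases h1.lt_or_eq with h | h
    · rcases h2.lt_or_eq with h' | h'
      · exact (R.neg t h h').le
      · rw [h', R.zth]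
    · rw [← h, iz]
  obtain ⟨T1, T2⟩ := cn_track F O hxa hya (b := th) (T := ttil + ρ) σ0 (R.thtb.trans R.tbT) ix iy iz
    nonpos (by rw [ix]; exact hε)
  rw [← hC] at T2
  obtain ⟨A, B⟩ := T2 th R.τth.le le_rfl
  have x0 := R.xth
  have lo : ttil - k ≤ th := by
    by_contra h
    push Not at h
    have := hc1 th R.τth.le h.le
    have := (abs_le.1 A).2
    linarith
  have hi : th ≤ ttil + k := by
    by_contra h
    push Not at h
    rcases hc2 with hc | ⟨t2, h1, h2, h3⟩
    · have := hc th h.le (R.thtb.trans R.tbT)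
      have := (abs_le.1 A).2
      linarith
    · have q1 := (abs_le.1 (T1 t2 (by linarith) (by linarith))).2
      have q2 := (abs_le.1 (T2 t2 (by linarith) (by linarith)).1).1
      have q3 := nonpos t2 (by linarith) (by linarith)
      linarith
  have ab : |th - ttil| ≤ k := abs_le.2 ⟨by linarith, by linarith⟩
  have X := cn_lip hxa (fun t => F.bf _ _ _) ttil th
  have Y := cn_lip hya (fun t => F.bg _ _ _) ttil th
  have : M * |th - ttil| ≤ M * k := by gcongr
  have tri1 := abs_sub_le (x th) (xa th) (xa ttil)
  have tri2 := abs_sub_le (y th) (ya th) (ya ttil)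
  refine ⟨by nlinarith, ?_, ?_⟩ <;> linarith

lemma cn_caseB {f g : ℝ → ℝ → ℝ → ℝ} {M lam ρ τ ttil yt : ℝ} (F : CFld f g M lam) (hρ : 0 < ρ)
    (hf : 0 < f 0 yt 0) :
    ∃ κ > 0, ∀ᶠ ε in 𝓝[>] (0 : ℝ), ∀ (x y z : ℝ → ℝ) (s th tb : ℝ), COrb f g ε x y z →
      CRun x z τ (ttil + ρ) th s tb →
      |th - ttil| ≤ κ → |x th| ≤ κ → |y th - yt| ≤ κ → False := by
  have hM := F.M0
  have hl := F.l0
  obtain ⟨m, hm⟩ : ∃ m, m = f 0 yt 0 / 2 := ⟨_, rfl⟩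
  have m0 : 0 < m := by linarith
  obtain ⟨d, hd⟩ : ∃ d, d = min (ρ / 3) (m / (lam * (4 + 3 * M) + 1)) := ⟨_, rfl⟩
  have d0 : 0 < d := by rw [hd]; exact lt_min (by linarith) (by positivity)
  have d1 : d ≤ ρ / 3 := by rw [hd]; exact min_le_left _ _
  have d2 : lam * (4 + 3 * M) * d ≤ m := by
    have : d ≤ m / (lam * (4 + 3 * M) + 1) := by rw [hd]; exact min_le_right _ _
    rw [le_div_iff₀ (by positivity)] at this
    linarith
  refine ⟨d, d0, ?_⟩
  have ev : ∀ c > 0, ∀ᶠ ε in 𝓝[>] (0 : ℝ), M * ε < c := by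
    intro c hc
    simpa using cn_small 0 M hc
  filter_upwards [ev d d0, ev (m * d) (by positivity)] with ε e1 e2 x y z s th tb O R h1 h2 h3
  have := abs_le.1 h1
  have Ts := R.Ts
  have bx : ∀ t, th ≤ t → t ≤ th + d → |x t| ≤ d + M * d ∧ |y t - yt| ≤ d + M * d := by
    intro t k1 k2
    have X := cn_lip_le O.hx (fun t => F.bf _ _ _) k1
    have Y := cn_lip_le O.hy (fun t => F.bg _ _ _) k1
    have : M * (t - th) ≤ M * d := by gcongr; linarith
    have tri1 := abs_sub_le (x t) (x th) 0
    have tri2 := abs_sub_le (y t) (y th) yt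
    simp only [sub_zero] at tri1
    constructor <;> linarith
  have zlow := cn_low (K := d + M * d) (a := th) (b := th + d) O.ε0 O.hz
    (by rw [R.zth]; have : 0 < d + M * d := by positivity
        linarith) (fun t k1 k2 => (abs_le.1 (bx t k1 k2).1).1)
  have bz : ∀ t, th ≤ t → t ≤ th + d → |z t| ≤ 2 * d + M * d := by
    intro t k1 k2
    have z1 := zlow t k1 k2
    refine abs_le.2 ⟨by linarith, ?_⟩
    by_cases hz : z t ≤ 0
    · have : 0 < M * d := by positivity
      linarith
    · push Not at hz
      have := cn_run O.ε0 hM O.hx (fun t => F.bf _ _ _) O.hz (t := t) (s := s) (by linarith)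
        (by rw [R.zs]; exact hz.le)
      have := (abs_le.1 (bx t k1 k2).1).1
      linarith
  have df : ∀ t, th ≤ t → t ≤ th + d → m ≤ f (x t) (y t) (z t) := by
    intro t k1 k2
    have A := (abs_le.1 (F.lf (x t) (y t) (z t) 0 yt 0)).1
    obtain ⟨b1, b2⟩ := bx t k1 k2
    have b3 := bz t k1 k2
    simp only [sub_zero] at A
    have : lam * (|x t| + |y t - yt| + |z t|) ≤ lam * ((4 + 3 * M) * d) := by
      gcongr; linarith
    linarith
  have xlow : ∀ t, th ≤ t → t ≤ th + d → m * (t - th) ≤ x t := by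
    intro t k1 k2
    have := cn_mono_lin O.hx k1 (fun r r1 r2 => df r r1 (by linarith))
    linarith [R.xth]
  have zm := cn_mono O.hz (a := th) (b := th + d) (fun t k1 k2 => by
    have := xlow t k1 k2
    have : 0 ≤ m * (t - th) := mul_nonneg m0.le (by linarith)
    have := abs_nonneg (z t)
    apply div_nonneg _ O.ε0.le
    linarith) th (th + d) le_rfl (by linarith) le_rfl
  rw [R.zth] at zm
  have := cn_run O.ε0 hM O.hx (fun t => F.bf _ _ _) O.hz (t := th + d) (s := s) (by linarith)
        (by rw [R.zs]; exact zm)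
  have := xlow (th + d) (by linarith) le_rfl
  have e : th + d - th = d := by ring
  rw [e] at this
  linarith

lemma cn_caseC {f g : ℝ → ℝ → ℝ → ℝ} {M lam δ ρ τ ttil κ : ℝ} (F : CFld f g M lam) (hδ : 0 < δ)
    (hyf : ∀ y : ℝ, y ≠ 0 → y * f 0 y 0 < 0)
    (hgpos : ∀ x y z : ℝ, |x| ≤ δ → |y| ≤ δ → |z| ≤ δ → 0 < g x y z)
    (hρδ : 2 * M * ρ < δ) (hκ : 0 < κ) :
    ∃ κ' > 0, ∀ᶠ ε in 𝓝[>] (0 : ℝ), ∀ (x y z : ℝ → ℝ) (s th tb : ℝ), COrb f g ε x y z →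
      CRun x z τ (ttil + ρ) th s tb →
      |th - ttil| ≤ κ' → |x th| ≤ κ' → |y th| ≤ κ' → tb ≤ th + κ := by
  have hM := F.M0
  have hl := F.l0
  obtain ⟨g0, g00, hg0⟩ := cn_cube hl hδ F.lg hgpos
  obtain ⟨k, hk⟩ : ∃ k, k = min ((δ / 2 - M * ρ) / (1 + M)) (g0 * κ / 4) := ⟨_, rfl⟩
  have k0 : 0 < k := by
    rw [hk]; refine lt_min (div_pos (by linarith) (by linarith)) (by positivity)
  have k1 : k + M * (ρ + k) ≤ δ / 2 := by
    have : k ≤ (δ / 2 - M * ρ) / (1 + M) := by rw [hk]; exact min_le_left _ _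
    rw [le_div_iff₀ (by linarith)] at this
    linarith
  have k2 : k ≤ g0 * κ / 4 := by rw [hk]; exact min_le_right _ _
  have c0 : 0 < g0 * κ / 4 := by positivity
  have fc : Continuous (fun y => f 0 y 0) := by
    apply LipschitzWith.continuous (K := ⟨lam, hl⟩)
    apply LipschitzWith.of_dist_le_mul
    intro p q
    change _ ≤ lam * _
    simpa [Real.dist_eq] using F.lf 0 p 0 0 q 0
  obtain ⟨m, m0, hm⟩ := cn_cpt fc (g0 * κ / 4) δ (fun y h1 _ => by
    have p : 0 < y := by linarith
    have := hyf y p.ne'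
    by_contra h
    push Not at h
    nlinarith)
  obtain ⟨h, hh⟩ : ∃ h, h = min (κ / 2) (m / (6 * (lam * M) + 1)) := ⟨_, rfl⟩
  have h0 : 0 < h := by rw [hh]; refine lt_min (by linarith) (by positivity)
  have h1 : h ≤ κ / 2 := by rw [hh]; exact min_le_left _ _
  have h2 : 6 * (lam * M * h) ≤ m := by
    have : h ≤ m / (6 * (lam * M) + 1) := by rw [hh]; exact min_le_right _ _
    rw [le_div_iff₀ (by positivity)] at this
    linarith
  obtain ⟨σ, hσ⟩ : ∃ σ, σ = min (h / 2) (min (M * h / 2) (m * h / 8)) := ⟨_, rfl⟩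
  have σ0 : 0 < σ := by
    rw [hσ]; refine lt_min (by linarith) (lt_min (by positivity) (by positivity))
  have σ1 : σ ≤ h / 2 := by rw [hσ]; exact min_le_left _ _
  have σ2 : σ ≤ M * h / 2 := by rw [hσ]; exact (min_le_right _ _).trans (min_le_left _ _)
  have σ3 : σ ≤ m * h / 8 := by rw [hσ]; exact (min_le_right _ _).trans (min_le_right _ _)
  refine ⟨k, k0, ?_⟩
  have ev : ∀ᶠ ε in 𝓝[>] (0 : ℝ), M * ε < δ / 2 := by
    simpa using cn_small 0 M (half_pos hδ)
  filter_upwards [ev, cn_small (δ / 2) M σ0] with ε e1 e2 x y z s th tb O R i1 i2 i3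
  by_contra hcon
  push Not at hcon
  have i1' := abs_le.1 i1
  have tbs : tb ≤ s := R.tbT.trans R.Ts
  have bxy : ∀ t, th ≤ t → t ≤ tb → |x t| ≤ δ / 2 ∧ |y t| ≤ δ / 2 := by
    intro t q1 q2
    have X := cn_lip_le O.hx (fun t => F.bf _ _ _) q1
    have Y := cn_lip_le O.hy (fun t => F.bg _ _ _) q1
    have : M * (t - th) ≤ M * (ρ + k) := by gcongr; linarith [R.tbT]
    have tri1 := abs_sub_le (x t) (x th) 0
    have tri2 := abs_sub_le (y t) (y th) 0
    simp only [sub_zero] at tri1 tri2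
    constructor <;> linarith
  have zlow := cn_low (K := δ / 2) (a := th) (b := tb) O.ε0 O.hz
    (by rw [R.zth]; linarith) (fun t k1 k2 => (abs_le.1 (bxy t k1 k2).1).1)
  have bz : ∀ t, th ≤ t → t ≤ tb → |z t| ≤ δ := by
    intro t q1 q2
    have z1 := zlow t q1 q2
    refine abs_le.2 ⟨by linarith, ?_⟩
    by_cases hz : z t ≤ 0
    · linarith
    · push Not at hz
      have ts : t < s := by
        rcases (q2.trans tbs).lt_or_eq with h | h
        · exact h
        · rw [h, R.zs] at hz; exact absurd hz (lt_irrefl _)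
      have := cn_run O.ε0 hM O.hx (fun t => F.bf _ _ _) O.hz ts (by rw [R.zs]; exact hz.le)
      have := (abs_le.1 (bxy t q1 q2).1).1
      linarith
  have ylow : ∀ t, th + κ / 2 ≤ t → t ≤ tb → g0 * κ / 4 ≤ y t := by
    intro t q1 q2
    have := cn_mono_lin (a := th) (b := t) (m := g0) O.hy (by linarith) (fun r r1 r2 => by
      obtain ⟨b1, b2⟩ := bxy r r1 (r2.trans q2)
      exact hg0 _ _ _ (by linarith) (by linarith) (bz r r1 (r2.trans q2)))
    have A := (abs_le.1 i3).1
    have : g0 * (κ / 2) ≤ g0 * (t - th) := by gcongr; linarith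
    linarith
  -- slope bound
  have slope : ∀ t, th + κ / 2 ≤ t → t ≤ tb → |x t| + |z t| ≤ 3 * (M * h) →
      f (x t) (y t) (z t) ≤ -(m / 2) := by
    intro t q1 q2 q3
    have A := (abs_le.1 (F.lf (x t) (y t) (z t) 0 (y t) 0)).2
    simp only [sub_zero, sub_self, abs_zero, add_zero] at A
    have B := hm (y t) (ylow t q1 q2) (by
      have := (abs_le.1 (bxy t (by linarith) q2).2).2
      linarith)
    have : lam * (|x t| + |z t|) ≤ lam * (3 * (M * h)) := by gcongr
    linarith
  obtain ⟨t1, t1a, t1b, t1n⟩ := R.zleft (th + κ) hcon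
  have zc : Continuous z := continuous_iff_continuousAt.2 fun t => (O.hz t).continuousAt
  obtain ⟨a, a1, a2, a3, a4⟩ := cn_last (h := fun t => - z t) zc.neg (a := th) (b := t1)
    (by linarith) (by simp [R.zth]) (by linarith)
  obtain ⟨b, b1, b2, b3, b4⟩ := cn_first (h := fun t => - z t) zc.neg (a := t1) (b := tb)
    t1b.le (by linarith) (by have := R.zpos tb le_rfl tbs; linarith)
  have za : z a = 0 := by linarith
  have zb : z b = 0 := by linarith
  have ab : a < b := a2.trans b1
  have zn : ∀ t, a < t → t < b → z t < 0 := by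
    intro t q1 q2
    by_cases q3 : t ≤ t1
    · have := a4 t q1 q3; linarith
    · have := b4 t (by linarith) q2; linarith
  have znn : ∀ t, a ≤ t → t ≤ b → z t ≤ 0 := by
    intro t q1 q2
    rcases q1.lt_or_eq with q1 | q1
    · rcases q2.lt_or_eq with q2 | q2
      · exact (zn t q1 q2).le
      · rw [q2, zb]
    · rw [← q1, za]
  have xa : x a ≤ 0 := by
    have := cn_deriv_left ab (O.hz a) za zn
    rw [za, abs_zero, add_zero, div_le_iff₀ O.ε0] at this
    linarith
  have xb : 0 ≤ x b := by
    have := cn_deriv_right ab (O.hz b) zb zn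
    rw [zb, abs_zero, add_zero, le_div_iff₀ O.ε0] at this
    linarith
  by_cases hab : b - h ≤ a
  · have bx : ∀ t, a ≤ t → t ≤ b → |x t| ≤ M * h := by
      intro t q1 q2
      have A := (abs_le.1 (cn_lip_le O.hx (fun t => F.bf _ _ _) q1)).2
      have B := (abs_le.1 (cn_lip_le O.hx (fun t => F.bf _ _ _) q2)).2
      have : M * (t - a) ≤ M * h := by gcongr; linarith
      have : M * (b - t) ≤ M * h := by gcongr; linarith
      exact abs_le.2 ⟨by linarith, by linarith⟩
    have Mh : 0 < M * h := by positivity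
    have zl := cn_low (K := M * h) (a := a) (b := b) O.ε0 O.hz (by rw [za]; linarith)
      (fun t q1 q2 => (abs_le.1 (bx t q1 q2)).1)
    have := cn_mono_lin (h := fun t => - x t) (m := m / 2) (fun t => (O.hx t).neg) ab.le
      (fun t q1 q2 => by
        have := slope t (by linarith) (by linarith) (by
          have := bx t q1 q2
          rw [abs_of_nonpos (znn t q1 q2)]
          linarith [zl t q1 q2])
        linarith)
    have : 0 < m / 2 * (b - a) := mul_pos (by linarith) (by linarith)
    linarith
  · push Not at hab
    have V : ∀ t, b - h / 2 ≤ t → t ≤ b → |x t - z t| ≤ σ := by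
      intro t q1 q2
      have := cn_decay (v := fun t => x t - z t) (a := a) (b := b) O.ε0 hM.le
        (fun t => (O.hx t).sub (O.hz t))
        (fun t q1 q2 => by
          have := F.bf (x t) (y t) (z t)
          rw [abs_of_nonpos (znn t q1 q2)]
          convert this using 2; ring) t (by linarith) q2
      simp only [za, sub_zero] at this
      have ε0 := O.ε0
      have e : Real.exp (-((t - a) / ε)) ≤ Real.exp (-(σ / ε)) := by
        apply Real.exp_le_exp.2; apply neg_le_neg; gcongr; linarith
      have := mul_le_mul (bxy a a1 (by linarith)).1 e (Real.exp_pos _).le (by linarith)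
      linarith
    have Vb := V b (by linarith) le_rfl
    rw [zb, sub_zero] at Vb
    have Vb2 := (abs_le.1 Vb).2
    have := cn_mono_lin (h := fun t => - x t) (m := m / 2) (fun t => (O.hx t).neg)
      (show b - h / 2 ≤ b by linarith)
      (fun t q1 q2 => by
        have := slope t (by linarith) (by linarith) (by
          have A := abs_le.1 (cn_lip_le O.hx (fun t => F.bf _ _ _) q2)
          have : M * (b - t) ≤ M * (h / 2) := by gcongr; linarith
          have B : |x t| ≤ M * h := abs_le.2 ⟨by linarith [A.1, A.2], by linarith [A.1, A.2]⟩
          have C := (abs_le.1 (V t q1 q2)).2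
          rw [abs_of_nonpos (znn t (by linarith) q2)]
          linarith [neg_abs_le (x t)])
        linarith)
    have Vl := (abs_le.1 (V (b - h / 2) le_rfl (by linarith))).2
    have zl := znn (b - h / 2) (by linarith) (by linarith)
    have : m / 2 * (b - (b - h / 2)) = m * h / 4 := by ring
    have : 0 < m * h := by positivity
    linarith

lemma cn_mkrun {x z : ℝ → ℝ} {τ T Tr ε th s tb : ℝ} (hε : 0 < ε)
    (hz : ∀ t, HasDerivAt z ((x t + |z t|) / ε) t) (x0 : x τ < 0) (z0 : z τ = 0) (τT : τ < T)
    (H1 : IsLeast {t | τ < t ∧ z t = 0} th)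
    (H2 : IsLeast (insert Tr {t | (T ≤ t ∧ t ≤ Tr) ∧ z t ≤ 0}) s)
    (H3 : s < Tr) (H4 : z s = 0)
    (H5 : IsLeast {t | t ≤ s ∧ ∀ ξ : ℝ, t ≤ ξ → ξ ≤ s → 0 ≤ z ξ} tb) :
    CRun x z τ T th s tb := by
  have zc : Continuous z := continuous_iff_continuousAt.2 fun t => (hz t).continuousAt
  obtain ⟨⟨a1, a2⟩, a3⟩ := H1
  obtain ⟨⟨c1, c2⟩, c3⟩ := H5
  have Ts : T ≤ s := by
    rcases H2.1 with h | h
    · exact absurd h H3.ne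
    · exact h.1.1
  have near : ∃ r, τ < r ∧ r < th ∧ z r < 0 := by
    by_contra hc
    push Not at hc
    have := cn_deriv_left (z := fun t => - z t) (a := τ) (b := th) a1 (hz τ).neg (by simp [z0])
      (fun t h1 h2 => by
        have A := hc t h1 h2
        have : z t ≠ 0 := fun h => by
          have := a3 ⟨h1, h⟩
          linarith
        have := lt_of_le_of_ne A this.symm
        linarith)
    rw [z0, abs_zero, add_zero] at this
    have : x τ / ε < 0 := div_neg_of_neg_of_pos x0 hε
    linarith
  obtain ⟨r, r1, r2, r3⟩ := near
  have neg : ∀ t, τ < t → t < th → z t < 0 := by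
    intro t h1 h2
    by_contra hc
    push Not at hc
    have : (0 : ℝ) ∈ z '' uIcc r t := intermediate_value_uIcc zc.continuousOn (mem_uIcc.2 (Or.inl ⟨r3.le, hc⟩))
    obtain ⟨q, hq, q0⟩ := this
    rw [mem_uIcc] at hq
    have q1 : τ < q := by rcases hq with h | h <;> linarith [h.1]
    have q2 : q < th := by rcases hq with h | h <;> linarith [h.2]
    have := a3 ⟨q1, q0⟩
    linarith
  refine ⟨a1, a2, neg, ?_, ?_, ?_, Ts, H4, c2, ?_⟩
  · have := cn_deriv_right a1 (hz th) a2 neg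
    rw [a2, abs_zero, add_zero, le_div_iff₀ hε] at this
    linarith
  · by_contra hc
    push Not at hc
    by_cases h : τ < tb
    · have := c2 tb le_rfl c1
      have := neg tb h hc
      linarith
    · push Not at h
      have q1 : τ < min s ((τ + th) / 2) := lt_min (by linarith) (by linarith)
      have q2 : min s ((τ + th) / 2) < th := (min_le_right _ _).trans_lt (by linarith)
      have := c2 _ (h.trans q1.le) (min_le_left _ _)
      have := neg _ q1 q2
      linarith
  · apply c3
    refine ⟨Ts, fun ξ h1 h2 => ?_⟩
    by_contra hc
    push Not at hc
    have := H2.2 (Or.inr ⟨⟨h1, h2.trans H3.le⟩, hc.le⟩)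
    have e : ξ = s := le_antisymm h2 this
    rw [e, H4] at hc
    exact lt_irrefl _ hc
  · intro t ht
    by_contra hc
    push Not at hc
    have : tb ≤ t := c3 ⟨ht.le.trans c1, fun ξ h1 h2 => by
      by_cases h : ξ < tb
      · exact hc ξ h1 h
      · exact c2 ξ (not_lt.1 h) h2⟩
    linarith

/-- In the canard setting, with
`t̄_ε = min{t ≤ s_ε : z_ε(ξ) ≥ 0 for all ξ ∈ [t, s_ε]}` and `w*_r = (x*_r, y*_r)`
the solution of the repulsive reduced system with `x(0) = y(0) = 0`, the supremum
over `t ∈ [t̄_ε, s_ε]` of `|x_ε(t) - x*_r(t - t̄_ε)| + |y_ε(t) - y*_r(t - t̄_ε)|`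
tends to `0` as `ε → 0` along those `ε` for which the stated hypotheses hold. -/
theorem slow_variables_close_to_repulsive
    (M lam δ ρ τ ttil Tr x₀ y₀ : ℝ) (hM : 0 < M) (hlam : 0 ≤ lam)
    (f g : ℝ → ℝ → ℝ → ℝ)
    -- Assumption 1: global boundedness and global Lipschitz continuity
    (hbound : ∀ x y z : ℝ, |f x y z| < M ∧ |g x y z| < M)
    (hLipf : ∀ x₁ y₁ z₁ x₂ y₂ z₂ : ℝ,
      |f x₁ y₁ z₁ - f x₂ y₂ z₂| ≤ lam * (|x₁ - x₂| + |y₁ - y₂| + |z₁ - z₂|))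
    (hLipg : ∀ x₁ y₁ z₁ x₂ y₂ z₂ : ℝ,
      |g x₁ y₁ z₁ - g x₂ y₂ z₂| ≤ lam * (|x₁ - x₂| + |y₁ - y₂| + |z₁ - z₂|))
    -- Assumption 2
    (hf000 : f 0 0 0 = 0) (hg000 : 0 < g 0 0 0)
    (hyf : ∀ y : ℝ, y ≠ 0 → y * f 0 y 0 < 0)
    -- choice of δ and ρ
    (hδ : 0 < δ)
    (hgpos : ∀ x y z : ℝ, |x| ≤ δ → |y| ≤ δ → |z| ≤ δ → 0 < g x y z)
    (hρ : 0 < ρ) (hρδ : ρ < δ / (2 * M))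
    -- the time moments
    (hτttil : τ < ttil) (httilTr : ttil < Tr) (httilρ : ttil + ρ < Tr)
    (hx₀ : x₀ < 0)
    -- (x_a, y_a) is the solution of the attractive reduced system
    (xa ya : ℝ → ℝ)
    (hxa : ∀ t : ℝ, HasDerivAt xa (f (xa t) (ya t) (xa t)) t)
    (hya : ∀ t : ℝ, HasDerivAt ya (g (xa t) (ya t) (xa t)) t)
    (hxaτ : xa τ = x₀) (hyaτ : ya τ = y₀)
    (hxaneg : ∀ t : ℝ, τ ≤ t → t < ttil → xa t < 0)
    -- (x_a(t̃), y_a(t̃)) ∈ R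
    (hR : (xa ttil = 0 ∧ ya ttil ≤ 0) ∨ (xa ttil ≤ 0 ∧ ya ttil = 0))
    -- for each ε > 0, (X ε, Y ε, Z ε) is the solution of the slow–fast system
    (X Y Z : ℝ → ℝ → ℝ)
    (hX : ∀ ε : ℝ, 0 < ε → ∀ t : ℝ,
      HasDerivAt (X ε) (f (X ε t) (Y ε t) (Z ε t)) t)
    (hY : ∀ ε : ℝ, 0 < ε → ∀ t : ℝ,
      HasDerivAt (Y ε) (g (X ε t) (Y ε t) (Z ε t)) t)
    (hZ : ∀ ε : ℝ, 0 < ε → ∀ t : ℝ,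
      HasDerivAt (Z ε) ((X ε t + |Z ε t|) / ε) t)
    (hIC : ∀ ε : ℝ, 0 < ε → X ε τ = x₀ ∧ Y ε τ = y₀ ∧ Z ε τ = 0)
    -- t̂_ε and s_ε
    (th s tb : ℝ → ℝ)
    -- w*_r = (x*_r, y*_r) is the solution of the repulsive reduced system with
    -- initial condition x(0) = y(0) = 0
    (xr yr : ℝ → ℝ)
    (hxr : ∀ t : ℝ, HasDerivAt xr (f (xr t) (yr t) (-(xr t))) t)
    (hyr : ∀ t : ℝ, HasDerivAt yr (g (xr t) (yr t) (-(xr t))) t)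
    (hxr0 : xr 0 = 0) (hyr0 : yr 0 = 0) :
    ∀ η > (0 : ℝ), ∃ ε₁ > (0 : ℝ), ∀ ε : ℝ, 0 < ε → ε < ε₁ →
      IsLeast {t | τ < t ∧ Z ε t = 0} (th ε) →
      IsLeast (insert Tr {t | (ttil + ρ ≤ t ∧ t ≤ Tr) ∧ Z ε t ≤ 0}) (s ε) →
      s ε < Tr → Z ε (s ε) = 0 →
      IsLeast {t | t ≤ s ε ∧ ∀ ξ : ℝ, t ≤ ξ → ξ ≤ s ε → 0 ≤ Z ε ξ} (tb ε) →
      ∀ t : ℝ, tb ε ≤ t → t ≤ s ε →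
        |X ε t - xr (t - tb ε)| + |Y ε t - yr (t - tb ε)| ≤ η := by
  have F : CFld f g M lam := ⟨hM, hlam, fun x y z => (hbound x y z).1.le,
    fun x y z => (hbound x y z).2.le, hLipf, hLipg⟩
  have hρδ' : 2 * M * ρ < δ := by
    rw [lt_div_iff₀ (by positivity)] at hρδ
    linarith
  intro η hη
  suffices H : ∀ᶠ ε in 𝓝[>] (0 : ℝ), ∀ (x y z : ℝ → ℝ) (s th tb : ℝ), COrb f g ε x y z →
      x τ = xa τ → y τ = ya τ → z τ = 0 → CRun x z τ (ttil + ρ) th s tb → s < Tr →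
      ∀ t, tb ≤ t → t ≤ s → |x t - xr (t - tb)| + |y t - yr (t - tb)| ≤ η by
    obtain ⟨ε₁, hε₁, H⟩ := mem_nhdsGT_iff_exists_Ioo_subset.1 H
    refine ⟨ε₁, hε₁, fun ε h1 h2 H1 H2 H3 H4 H5 => ?_⟩
    obtain ⟨q1, q2, q3⟩ := hIC ε h1
    refine H ⟨h1, h2⟩ (X ε) (Y ε) (Z ε) (s ε) (th ε) (tb ε) ⟨h1, hX ε h1, hY ε h1, hZ ε h1⟩
      (by rw [q1, hxaτ]) (by rw [q2, hyaτ]) q3 ?_ H3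
    exact cn_mkrun h1 (hZ ε h1) (by rw [q1]; exact hx₀) q3 (by linarith) H1 H2 H3 H4 H5
  have haft : (∀ t, ttil < t → t ≤ ttil + ρ → xa t < 0) ∨
      (∀ κ > 0, ∃ t2, ttil < t2 ∧ t2 < ttil + κ ∧ 0 < xa t2) := by
    by_cases hy : ya ttil = 0
    · exact Or.inl (cn_reduced F hyf hgpos hρδ' hxa hya (by rcases hR with h | h <;> linarith [h.1]) hy)
    · obtain ⟨r1, r2⟩ : xa ttil = 0 ∧ ya ttil ≤ 0 := by tauto
      right
      intro κ hκ
      by_contra hc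
      push Not at hc
      have r3 : ya ttil < 0 := lt_of_le_of_ne r2 hy
      have d := hxa ttil
      rw [r1] at d
      have := hyf _ hy
      have h := (hasDerivAt_iff_tendsto_slope.1 d).mono_left
        (nhdsWithin_mono ttil (fun t (ht : ttil < t) => ht.ne') : 𝓝[>] ttil ≤ 𝓝[≠] ttil)
      have : f 0 (ya ttil) 0 ≤ 0 := by
        refine le_of_tendsto h ?_
        filter_upwards [Ioo_mem_nhdsGT (show ttil < ttil + κ by linarith)] with t ht
        rw [slope_def_field, r1]
        have := hc t ht.1 ht.2
        exact div_nonpos_of_nonpos_of_nonneg (by linarith) (by linarith [ht.1])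
      nlinarith
  have near := fun {κ : ℝ} (hκ : 0 < κ) => cn_near F hxa hya hτttil hxaneg haft hκ
  -- case A
  by_cases cA : xa ttil < 0
  · filter_upwards [near (κ := -xa ttil / 2) (by linarith)] with ε N x y z s th tb O ix iy iz R
    exfalso
    have := (abs_le.1 (N x y z s th tb O ix iy iz R).2.1).2
    linarith [R.xth]
  have x0 : xa ttil = 0 := by
    rcases hR with h | h
    · exact h.1
    · linarith [h.1]
  -- case B
  by_cases cB : ya ttil < 0
  · have f0 : 0 < f 0 (ya ttil) 0 := by
      have := hyf _ cB.ne
      by_contra h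
      push Not at h
      nlinarith
    obtain ⟨κ, hκ, hB⟩ := cn_caseB (τ := τ) (ttil := ttil) F hρ f0
    filter_upwards [near hκ, hB] with ε N hB x y z s th tb O ix iy iz R
    obtain ⟨n1, n2, n3⟩ := N x y z s th tb O ix iy iz R
    rw [x0, sub_zero] at n2
    exact (hB x y z s th tb O R n1 n2 n3).elim
  have y0 : ya ttil = 0 := by
    rcases hR with h | h
    · linarith [h.2]
    · exact h.2
  -- case C
  obtain ⟨E, hE⟩ : ∃ E, E = Real.exp ((3 * lam + 1) * (Tr - τ)) := ⟨_, rfl⟩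
  have E0 : 0 < E := by rw [hE]; positivity
  obtain ⟨κ, hκ⟩ : ∃ κ, κ = η / (4 * (E * (1 + M))) := ⟨_, rfl⟩
  have κ0 : 0 < κ := by rw [hκ]; positivity
  obtain ⟨σ, hσ⟩ : ∃ σ, σ = η / (4 * (lam * E + 2 * M)) := ⟨_, rfl⟩
  have σ0 : 0 < σ := by rw [hσ]; positivity
  have e1 : (κ + M * κ) * E = η / 4 := by rw [hκ]; field_simp
  have e2 : lam * σ * E + 2 * M * σ = η / 4 := by
    have : lam * E + 2 * M ≠ 0 := by positivity
    rw [hσ]; field_simp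
  obtain ⟨κ', hκ', hC⟩ := cn_caseC (τ := τ) (ttil := ttil) F hδ hyf hgpos hρδ' κ0
  filter_upwards [near (lt_min hκ' κ0), hC, cn_small (|x₀| + M * (Tr - τ)) M σ0] with
    ε N hC hε x y z s th tb O ix iy iz R sTr
  obtain ⟨n1, n2, n3⟩ := N x y z s th tb O ix iy iz R
  rw [x0, sub_zero] at n2
  rw [y0, sub_zero] at n3
  have m1 := min_le_left κ' κ
  have m2 := min_le_right κ' κ
  have tbth := hC x y z s th tb O R (n1.trans m1) (n2.trans m1) (n3.trans m1)
  have Lx := cn_lip_le O.hx (fun t => F.bf _ _ _) R.thtb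
  have Ly := cn_lip_le O.hy (fun t => F.bg _ _ _) R.thtb
  have hMκ : M * (tb - th) ≤ M * κ := by gcongr; linarith
  have tx := abs_sub_le (x tb) (x th) 0
  have ty := abs_sub_le (y tb) (y th) 0
  simp only [sub_zero] at tx ty
  have tbs : tb ≤ s := R.tbT.trans R.Ts
  have τs : τ ≤ s := by linarith [R.Ts]
  have ττb : τ ≤ tb := R.τth.le.trans R.thtb
  have Ls := cn_lip_le O.hx (fun t => F.bf _ _ _) τs
  have hMs : M * (s - τ) ≤ M * (Tr - τ) := by gcongr
  have ts := abs_sub_le (x s) (x τ) 0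
  simp only [sub_zero] at ts
  rw [ix, hxaτ] at ts Ls
  have fin := cn_final (κ := κ + M * κ) (L := Tr - τ) F O hxr hyr hxr0 hyr0 σ0 (by positivity) tbs
    (by linarith) (by linarith) (by linarith) R.zs R.zpos (by linarith) hε
  intro t h1 h2
  obtain ⟨u1, u2⟩ := fin t h1 h2
  rw [← hE] at u1 u2
  have e3 : (κ + M * κ + lam * σ) * E = (κ + M * κ) * E + lam * σ * E := by ring
  linarith
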